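/- Let (X,𝒳,ρ) be a probability space, S : X → X a measurable bijection with measurable inverse such that both S and S⁻¹ preserve ρ, H a separable complex Hilbert space, U₀ a unitary operator on H, and k : X → ℤ measurable. Let W be a linear isometric equivalence of L²(ρ; H) such that for every x ∈ L²(ρ; H), W x agrees ρ-almost everywhere with p ↦ U₀^{k(p)}(x(S p)). Let R be a closed subspace of H with U₀(R) = R. Then V_R := {x ∈ L²(ρ; H) : x(p) ∈ R for ρ-almost every p} is a closed subspace of L²(ρ; H) and W(V_R) = V_R. -/

import Mathlib

open MeasureTheory

/-- The functions in `Lp` with values almost everywhere in a closed set form a closed set. -/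
theorem isClosed_setOf_ae_mem_Lp {X E : Type*} [MeasurableSpace X] {μ : Measure X}
    [NormedAddCommGroup E] {p : ENNReal} [Fact (1 ≤ p)] {s : Set E} (hs : IsClosed s) :
    IsClosed {x : Lp E p μ | ∀ᵐ a ∂μ, x a ∈ s} := by
  refine isClosed_of_closure_subset fun x hx => ?_
  obtain ⟨u, hu, hux⟩ := mem_closure_iff_seq_limit.1 hx
  obtain ⟨n, -, hn⟩ := (tendstoInMeasure_of_tendsto_Lp hux).exists_seq_tendsto_ae
  filter_upwards [hn, ae_all_iff.2 hu] with a ha hua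
  exact hs.mem_of_tendsto ha (Filter.Eventually.of_forall fun i => hua (n i))

/-- A set fixed by a linear isometric equivalence is preserved in both directions by all
its integer powers. -/
theorem LinearIsometryEquiv.zpow_apply_mem_iff {𝕜 E : Type*} [Semiring 𝕜]
    [SeminormedAddCommGroup E] [Module 𝕜 E] (U : E ≃ₗᵢ[𝕜] E) {s : Set E} (hs : U '' s = s)
    (n : ℤ) (y : E) : (U ^ n) y ∈ s ↔ y ∈ s := by
  have hU : ∀ z, U z ∈ s ↔ z ∈ s := fun z => by
    conv_lhs => rw [← hs]
    exact U.injective.mem_set_image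
  induction n with
  | zero => simp
  | succ n ih =>
    refine Iff.trans ?_ ih
    rw [add_comm, zpow_add, zpow_one, LinearIsometryEquiv.coe_mul, Function.comp_apply, hU]
  | pred n ih =>
    refine Iff.trans ?_ ih
    rw [← hU, ← Function.comp_apply (f := U), ← LinearIsometryEquiv.coe_mul,
      ← zpow_one_add, add_sub_cancel]

/-- For the skew product unitary `W` on `L²(ρ; H)` and a closed `U₀`-invariant subspace
`R ⊆ H`, the set `V_R` of elements of `L²(ρ; H)` taking values in `R` almost everywhere
is a closed subspace with `W(V_R) = V_R`. -/
theorem stmt_9 {X : Type*} [MeasurableSpace X] (ρ : Measure X) [IsProbabilityMeasure ρ]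
    (S : X ≃ X) (hS : Measurable S) (hS' : Measurable S.symm)
    (hSρ : MeasurePreserving S ρ ρ) (hS'ρ : MeasurePreserving S.symm ρ ρ)
    {H : Type*} [NormedAddCommGroup H] [InnerProductSpace ℂ H] [CompleteSpace H]
    [TopologicalSpace.SeparableSpace H]
    (U₀ : H ≃ₗᵢ[ℂ] H) (k : X → ℤ) (hk : Measurable k)
    (W : Lp H 2 ρ ≃ₗᵢ[ℂ] Lp H 2 ρ)
    (hW : ∀ x : Lp H 2 ρ, (W x : X → H) =ᵐ[ρ] fun p => (U₀ ^ k p) (x (S p)))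
    (R : Submodule ℂ H) (hRclosed : IsClosed (R : Set H))
    (hR : U₀ '' (R : Set H) = (R : Set H))
    (VR : Set (Lp H 2 ρ)) (hVR : VR = {x : Lp H 2 ρ | ∀ᵐ p ∂ρ, x p ∈ R}) :
    IsClosed VR ∧ (0 : Lp H 2 ρ) ∈ VR ∧
    (∀ x ∈ VR, ∀ y ∈ VR, x + y ∈ VR) ∧
    (∀ (c : ℂ), ∀ x ∈ VR, c • x ∈ VR) ∧
    W '' VR = VR := by
  subst hVR
  have hS_iff (x : X → H) : (∀ᵐ p ∂ρ, x (S p) ∈ R) ↔ ∀ᵐ p ∂ρ, x p ∈ R :=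
    ⟨fun h => by simpa using hS'ρ.quasiMeasurePreserving.ae h,
      fun h => hSρ.quasiMeasurePreserving.ae h⟩
  have hW_iff (x : Lp H 2 ρ) : (∀ᵐ p ∂ρ, W x p ∈ R) ↔ ∀ᵐ p ∂ρ, x p ∈ R := by
    rw [← hS_iff x]
    refine Filter.eventually_congr ?_
    filter_upwards [hW x] with p hp
    rw [hp]
    exact U₀.zpow_apply_mem_iff hR (k p) (x (S p))
  refine ⟨isClosed_setOf_ae_mem_Lp hRclosed, ?_, fun x hx y hy => ?_, fun c x hx => ?_, ?_⟩
  · filter_upwards [Lp.coeFn_zero H 2 ρ] with p hp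
    rw [hp]
    exact R.zero_mem
  · rw [Set.mem_ofPred_eq] at *
    filter_upwards [Lp.coeFn_add x y, hx, hy] with p hp hxp hyp
    rw [hp]
    exact R.add_mem hxp hyp
  · rw [Set.mem_ofPred_eq] at *
    filter_upwards [Lp.coeFn_smul c x, hx] with p hp hxp
    rw [hp]
    exact R.smul_mem c hxp
  · ext y
    obtain ⟨x, rfl⟩ := W.surjective y
    rw [W.injective.mem_set_image]
    exact (hW_iff x).symm
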